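/- arXiv:0706.2876 — 5 statements merged into one kernel-verified Lean document; each statement's English description precedes it below -/
import Mathlib

section
/- Let n be a positive integer, and for each nonnegative integer t let A(t) be an n×n row-stochastic matrix with nonnegative entries a_{ij}(t). Assume: (Assumption 1) there exists α > 0 such that a_{ii}(t) ≥ α for all i and t, and for all i, j, t, either a_{ij}(t) = 0 or a_{ij}(t) ≥ α; (Assumption 2) there exists a positive integer B such that for every nonnegative integer k, the directed graph on vertex set {1,…,n} whose edge set is the union over t = kB, kB+1, …, (k+1)B of the edge sets E(t) = {(j,i) : a_{ij}(t) > 0} is strongly connected. Then for every initial vector x(0) ∈ ℝⁿ, defining x(t+1) = A(t) x(t) for all t ≥ 0, there exists a constant c ∈ ℝ such that for every i ∈ {1,…,n}, the sequence x_i(t) converges to c as t → ∞. -/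
open Matrix Filter

/-- A matrix is (row-)stochastic if its entries are nonnegative and each row sums to 1. -/
def IsStochastic {n : ℕ} (A : Matrix (Fin n) (Fin n) ℝ) : Prop :=
  (∀ i j, 0 ≤ A i j) ∧ (∀ i, ∑ j, A i j = 1)

/-- If a relation `r` reaches a point outside `S` from a point of `S`, some `r`-step leaves `S`. -/
theorem Relation.ReflTransGen.exists_step_leaving {V : Type*} {r : V → V → Prop} {S : Set V}
    {u v : V} (h : Relation.ReflTransGen r u v) (hu : u ∈ S) (hv : v ∉ S) :
    ∃ a ∈ S, ∃ b ∉ S, r a b := by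
  induction h with
  | refl => exact absurd hu hv
  | @tail b c _ hbc ih =>
    by_cases hb : b ∈ S
    · exact ⟨b, hb, c, hv, hbc⟩
    · exact ih hb

/-- A growing family of sets that absorbs the heads of the edges `E t` leaving it fills the whole
vertex set in bounded time, if the union of the edges over each window is strongly connected. -/
theorem eq_univ_of_windows_stronglyConnected {V : Type*} [Fintype V]
    {E : ℕ → V → V → Prop} {B : ℕ} (hB : 0 < B)
    (hE : ∀ k : ℕ, ∀ u v : V, Relation.ReflTransGen
      (fun j i => ∃ t : ℕ, k * B ≤ t ∧ t ≤ (k + 1) * B ∧ E t j i) u v)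
    {S : ℕ → Finset V} (hS : Monotone S) (hne : (S 0).Nonempty)
    (hstep : ∀ t j i, j ∈ S t → E t j i → i ∈ S (t + 1)) :
    S (2 * Fintype.card V * B) = Finset.univ := by
  obtain ⟨u, hu⟩ := hne
  have key : ∀ r : ℕ, S (2 * r * B) = Finset.univ ∨ r ≤ (S (2 * r * B)).card := by
    intro r
    induction r with
    | zero => exact Or.inr (Nat.zero_le _)
    | succ r ih =>
      have hle : S (2 * r * B) ⊆ S (2 * (r + 1) * B) := hS (by gcongr; omega)
      by_cases hfull : S (2 * r * B) = Finset.univ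
      · exact Or.inl (Finset.univ_subset_iff.mp (hfull ▸ hle))
      · right
        obtain ⟨v, hv⟩ : ∃ v, v ∉ S (2 * r * B) := by
          simpa [Finset.eq_univ_iff_forall] using hfull
        obtain ⟨a, ha, b, hb, t, ht, ht', hab⟩ :=
          (hE (2 * r) u v).exists_step_leaving (S := (S (2 * r * B) : Set V))
            (hS (Nat.zero_le _) hu) hv
        have hb' : b ∈ S (2 * (r + 1) * B) :=
          hS (show t + 1 ≤ 2 * (r + 1) * B by nlinarith) (hstep t a b (hS ht ha) hab)
        have hlt : S (2 * r * B) ⊂ S (2 * (r + 1) * B) :=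
          Finset.ssubset_iff_subset_ne.mpr ⟨hle, fun h => hb (by simpa [h] using hb')⟩
        exact (ih.resolve_left hfull).trans_lt (Finset.card_lt_card hlt)
  exact (key _).elim id fun h => Finset.card_eq_iff_eq_univ _ |>.mp
    (le_antisymm (Finset.card_le_univ _) h)

namespace IsStochastic

variable {n : ℕ} {A : Matrix (Fin n) (Fin n) ℝ}

theorem mulVec_sub (hA : IsStochastic A) (y : Fin n → ℝ) (m : ℝ) (i : Fin n) :
    (A *ᵥ y) i - m = ∑ j, A i j * (y j - m) := by
  simp [mul_sub, Finset.sum_sub_distrib, ← Finset.sum_mul, hA.2 i, Matrix.mulVec, dotProduct]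

theorem le_mulVec (hA : IsStochastic A) {y : Fin n → ℝ} {m : ℝ} (hy : ∀ j, m ≤ y j)
    (i : Fin n) : m ≤ (A *ᵥ y) i := by
  rw [← sub_nonneg, hA.mulVec_sub]
  exact Finset.sum_nonneg fun j _ => mul_nonneg (hA.1 i j) (sub_nonneg.mpr (hy j))

theorem mulVec_le (hA : IsStochastic A) {y : Fin n → ℝ} {M : ℝ} (hy : ∀ j, y j ≤ M)
    (i : Fin n) : (A *ᵥ y) i ≤ M := by
  rw [← sub_nonpos, hA.mulVec_sub]
  exact Finset.sum_nonpos fun j _ =>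
    mul_nonpos_of_nonneg_of_nonpos (hA.1 i j) (sub_nonpos.mpr (hy j))

theorem mul_le_mulVec_sub (hA : IsStochastic A) {y : Fin n → ℝ} {m α : ℝ} (hy : ∀ j, m ≤ y j)
    {i j : Fin n} (hα : α ≤ A i j) : α * (y j - m) ≤ (A *ᵥ y) i - m := by
  rw [hA.mulVec_sub]
  exact (mul_le_mul_of_nonneg_right hα (sub_nonneg.mpr (hy j))).trans
    (Finset.single_le_sum (f := fun j => A i j * (y j - m))
      (fun j _ => mul_nonneg (hA.1 i j) (sub_nonneg.mpr (hy j))) (Finset.mem_univ j))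

end IsStochastic

/-- After `2 * n` windows, every agent is above the lower bound `m` by a fixed fraction of the
initial excess of any given agent. -/
theorem pow_mul_sub_le_of_windows_stronglyConnected {n : ℕ} {A : ℕ → Matrix (Fin n) (Fin n) ℝ}
    (hA : ∀ t, IsStochastic (A t)) {α : ℝ} (hα : 0 < α) (hdiag : ∀ t i, α ≤ A t i i)
    (hentry : ∀ t i j, A t i j = 0 ∨ α ≤ A t i j) {B : ℕ} (hB : 0 < B)
    (hconn : ∀ k : ℕ, ∀ u v : Fin n, Relation.ReflTransGen
      (fun j i => ∃ t : ℕ, k * B ≤ t ∧ t ≤ (k + 1) * B ∧ 0 < A t i j) u v)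
    {x : ℕ → Fin n → ℝ} (hx : ∀ t, x (t + 1) = A t *ᵥ x t) {m : ℝ} (hm : ∀ j, m ≤ x 0 j)
    (u i : Fin n) :
    α ^ (2 * n * B) * (x 0 u - m) ≤ x (2 * n * B) i - m := by
  have hmx : ∀ t j, m ≤ x t j := by
    intro t
    induction t with
    | zero => exact hm
    | succ t ih => exact hx t ▸ (hA t).le_mulVec ih
  classical
  let S : ℕ → Finset (Fin n) := fun t => {i | α ^ t * (x 0 u - m) ≤ x t i - m}
  have hmem : ∀ t i, i ∈ S t ↔ α ^ t * (x 0 u - m) ≤ x t i - m := fun t i => by simp [S]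
  have hstep : ∀ t j i, j ∈ S t → α ≤ A t i j → i ∈ S (t + 1) := by
    intro t j i hj hij
    rw [hmem] at hj ⊢
    calc α ^ (t + 1) * (x 0 u - m) = α * (α ^ t * (x 0 u - m)) := by ring
      _ ≤ α * (x t j - m) := by gcongr
      _ ≤ x (t + 1) i - m := hx t ▸ (hA t).mul_le_mulVec_sub (hmx t) hij
  have hfull := eq_univ_of_windows_stronglyConnected (S := S) hB hconn
    (monotone_nat_of_le_succ fun t j hj => hstep t j j hj (hdiag t j))
    ⟨u, by simp [hmem]⟩
    (fun t j i hj hij => hstep t j i hj ((hentry t i j).resolve_left hij.ne'))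
  rw [Fintype.card_fin] at hfull
  exact (hmem _ _).mp (hfull ▸ Finset.mem_univ i)

/-- **Convergence of the agreement algorithm.**
Let `A t` be row-stochastic matrices.  Assumption 1: there is `α > 0` such that all
diagonal entries satisfy `A t i i ≥ α`, and every entry is either `0` or at least `α`.
Assumption 2: there is a positive integer `B` such that for every `k`, the directed graph
whose edges are the pairs `(j,i)` with `A t i j > 0` for some `t ∈ [kB, (k+1)B]` is
strongly connected (every node can reach every node).  Then for every trajectory
`x (t+1) = A t *ᵥ x t`, all components `x t i` converge to a common limit `c`. -/
theorem agreement_algorithm_converges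
    (n : ℕ) (hn : 0 < n)
    (A : ℕ → Matrix (Fin n) (Fin n) ℝ)
    (hstoch : ∀ t, IsStochastic (A t))
    (hassum1 : ∃ α : ℝ, 0 < α ∧ (∀ t i, α ≤ A t i i) ∧
      (∀ t i j, A t i j = 0 ∨ α ≤ A t i j))
    (hassum2 : ∃ B : ℕ, 0 < B ∧ ∀ k : ℕ, ∀ u v : Fin n,
      Relation.ReflTransGen
        (fun j i => ∃ t : ℕ, k * B ≤ t ∧ t ≤ (k + 1) * B ∧ 0 < A t i j) u v)
    (x : ℕ → Fin n → ℝ)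
    (hx : ∀ t, x (t + 1) = A t *ᵥ x t) :
    ∃ c : ℝ, ∀ i : Fin n, Tendsto (fun t => x t i) atTop (nhds c) := by
  obtain ⟨α, hα, hdiag, hentry⟩ := hassum1
  obtain ⟨B, hB, hconn⟩ := hassum2
  have : Nonempty (Fin n) := ⟨⟨0, hn⟩⟩
  let m : ℕ → ℝ := fun t => ⨅ i, x t i
  let M : ℕ → ℝ := fun t => ⨆ i, x t i
  have hmx : ∀ t i, m t ≤ x t i := fun t i => ciInf_le (Set.finite_range _).bddBelow i
  have hxM : ∀ t i, x t i ≤ M t := fun t i => le_ciSup (Set.finite_range _).bddAbove i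
  have hm : Monotone m := monotone_nat_of_le_succ fun t =>
    le_ciInf fun i => hx t ▸ (hstoch t).le_mulVec (hmx t) i
  have hM : Antitone M := antitone_nat_of_succ_le fun t =>
    ciSup_le fun i => hx t ▸ (hstoch t).mulVec_le (hxM t) i
  have hmM : ∀ t, m t ≤ M t := fun t => (hmx t ⟨0, hn⟩).trans (hxM t ⟨0, hn⟩)
  have hm_lim := tendsto_atTop_ciSup hm
    ⟨M 0, Set.forall_mem_range.mpr fun t => (hmM t).trans (hM t.zero_le)⟩
  have hM_lim := tendsto_atTop_ciInf hM
    ⟨m 0, Set.forall_mem_range.mpr fun t => (hm t.zero_le).trans (hmM t)⟩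
  set c := ⨆ t, m t
  set d := ⨅ t, M t
  have hgap : ∀ k, α ^ (2 * n * B) * (M (k * B) - m (k * B)) ≤
      m (k * B + 2 * n * B) - m (k * B) := by
    intro k
    obtain ⟨u, hu⟩ := exists_eq_ciSup_of_finite (f := x (k * B))
    obtain ⟨i, hi⟩ := exists_eq_ciInf_of_finite (f := x (k * B + 2 * n * B))
    have h := pow_mul_sub_le_of_windows_stronglyConnected
      (A := fun t => A (k * B + t)) (x := fun t => x (k * B + t))
      (fun t => hstoch _) hα (fun t => hdiag _) (fun t => hentry _) hB
      (fun l a b => Relation.ReflTransGen.mono (fun p q ⟨t, h1, h2, h3⟩ =>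
        ⟨t - k * B, by rw [add_mul] at h1; omega, by rw [add_assoc, add_mul] at h2; omega, by
          rwa [Nat.add_sub_cancel' (by rw [add_mul] at h1; omega)]⟩) _ _ (hconn (k + l) a b))
      (fun t => hx _) (hmx (k * B)) u i
    simpa only [add_zero, hu, hi] using h
  have hkB : Tendsto (fun k : ℕ => k * B) atTop atTop :=
    tendsto_atTop_mono (fun k => Nat.le_mul_of_pos_right k hB) tendsto_id
  have hkBL : Tendsto (fun k : ℕ => k * B + 2 * n * B) atTop atTop :=
    tendsto_atTop_mono (fun k => Nat.le_add_right _ _) hkB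
  have hlim := le_of_tendsto_of_tendsto'
    (((hM_lim.comp hkB).sub (hm_lim.comp hkB)).const_mul (α ^ (2 * n * B)))
    ((hm_lim.comp hkBL).sub (hm_lim.comp hkB)) hgap
  have hcd : d = c := by
    refine le_antisymm ?_ (le_of_tendsto_of_tendsto' hm_lim hM_lim hmM)
    rw [sub_self] at hlim
    exact sub_nonpos.mp (nonpos_of_mul_nonpos_right hlim (pow_pos hα _))
  exact ⟨c, fun i => tendsto_of_tendsto_of_tendsto_of_le_of_le hm_lim (hcd ▸ hM_lim)
    (fun t => hmx t i) (fun t => hxM t i)⟩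
end

section
/- Let M ∈ ℝ^{n×n} be a matrix in the class 𝒬, let 𝒫 be the set of all n×n permutation matrices, and define Z = Σ_{P ∈ 𝒫} PᵀMP. Then Z belongs to 𝒬. -/
open Matrix

/-- The class `𝒜` of matrices of one iteration of the symmetric equal-neighbor algorithm:
stochastic matrices with (i) positive diagonal, (ii) all positive entries of a row equal,
(iii) symmetric sparsity pattern, (iv) connected associated graph (any two nodes are joined
by a path along pairs with positive entries). -/
def MemA {n : ℕ} (A : Matrix (Fin n) (Fin n) ℝ) : Prop :=
  IsStochastic A ∧
  (∀ i, 0 < A i i) ∧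
  (∀ i j k, 0 < A i j → 0 < A i k → A i j = A i k) ∧
  (∀ i j, 0 < A i j ↔ 0 < A j i) ∧
  (∀ i j : Fin n, Relation.ReflTransGen (fun a b => 0 < A a b) i j)

/-- The class `𝒬` of (matrices of) candidate quadratic Lyapunov functions: `M` is nonzero,
symmetric, positive semidefinite, `M e = 0` for the all-ones vector `e`, and
`(Ax)ᵀ M (Ax) ≤ xᵀ M x` for every `A ∈ 𝒜` and every `x`. -/
def MemQ {n : ℕ} (M : Matrix (Fin n) (Fin n) ℝ) : Prop :=
  M ≠ 0 ∧ M.IsSymm ∧ M.PosSemidef ∧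
  M *ᵥ (fun _ => (1 : ℝ)) = 0 ∧
  ∀ A : Matrix (Fin n) (Fin n) ℝ, MemA A →
    ∀ x : Fin n → ℝ, (A *ᵥ x) ⬝ᵥ (M *ᵥ (A *ᵥ x)) ≤ x ⬝ᵥ (M *ᵥ x)

/-- `P` is a permutation matrix: for some permutation `σ`, `(Px)_i = x_{σ(i)}` for all `x`. -/
def IsPermMatrix {n : ℕ} (P : Matrix (Fin n) (Fin n) ℝ) : Prop :=
  ∃ σ : Equiv.Perm (Fin n), ∀ (x : Fin n → ℝ) (i : Fin n), (P *ᵥ x) i = x (σ i)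

/-- The permutation matrix of a permutation `σ`, satisfying `(Px)_i = x_{σ(i)}`. -/
def permMatrix {n : ℕ} (σ : Equiv.Perm (Fin n)) : Matrix (Fin n) (Fin n) ℝ :=
  fun i j => if j = σ i then 1 else 0

/-- The sample variance `V(x) = ∑ i (x_i - x̄)²` where `x̄` is the average of the `x_i`. -/
noncomputable def sampleVar {n : ℕ} (x : Fin n → ℝ) : ℝ :=
  ∑ i, (x i - (∑ j, x j) / n) ^ 2

theorem permMatrix_conj_eq_submatrix {n : ℕ} (M : Matrix (Fin n) (Fin n) ℝ)
    (σ : Equiv.Perm (Fin n)) :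
    (permMatrix σ)ᵀ * M * permMatrix σ = M.submatrix σ.symm σ.symm := by
  have h : ∀ i k : Fin n, permMatrix σ k i = if k = σ.symm i then 1 else 0 := fun i k => by
    simp only [permMatrix, Equiv.eq_symm_apply, eq_comm]
  ext i j
  simp [Matrix.mul_apply, h]

theorem MemA.submatrix {n : ℕ} {A : Matrix (Fin n) (Fin n) ℝ} (hA : MemA A)
    (τ : Equiv.Perm (Fin n)) : MemA (A.submatrix τ τ) := by
  obtain ⟨⟨hnonneg, hsum⟩, hdiag, hrow, hsymm, hconn⟩ := hA
  refine ⟨⟨fun i j => hnonneg _ _, fun i => ?_⟩, fun i => hdiag _, fun i j k => hrow _ _ _,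
    fun i j => hsymm _ _, fun i j => ?_⟩
  · simpa using (Equiv.sum_comp τ (A (τ i))).trans (hsum (τ i))
  · simpa [Function.onFun] using (hconn (τ i) (τ j)).lift
      (p := fun a b => 0 < A.submatrix τ τ a b) τ.symm
      (fun a b h => by simpa [Function.onFun] using h)

theorem dotProduct_submatrix_mulVec {n : ℕ} (M : Matrix (Fin n) (Fin n) ℝ)
    (τ : Equiv.Perm (Fin n)) (x : Fin n → ℝ) :
    x ⬝ᵥ (M.submatrix τ τ *ᵥ x) = (x ∘ τ.symm) ⬝ᵥ (M *ᵥ (x ∘ τ.symm)) := by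
  rw [Matrix.submatrix_mulVec_equiv, comp_equiv_symm_dotProduct]

theorem MemQ.submatrix {n : ℕ} {M : Matrix (Fin n) (Fin n) ℝ} (hM : MemQ M)
    (τ : Equiv.Perm (Fin n)) : MemQ (M.submatrix τ τ) := by
  obtain ⟨hne, hsymm, hpos, hker, hdec⟩ := hM
  refine ⟨fun h => hne ?_, hsymm.submatrix _, hpos.submatrix _, ?_, fun A hA x => ?_⟩
  · ext i j
    simpa using congrFun (congrFun h (τ.symm i)) (τ.symm j)
  · rw [Matrix.submatrix_mulVec_equiv]
    exact congrArg (· ∘ τ) hker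
  · have key := hdec _ (hA.submatrix τ.symm) (x ∘ τ.symm)
    rw [Matrix.submatrix_mulVec_equiv, Equiv.symm_symm, Function.comp_assoc,
      Equiv.symm_comp_self, Function.comp_id] at key
    rwa [dotProduct_submatrix_mulVec, dotProduct_submatrix_mulVec]

theorem MemQ.add {n : ℕ} {M N : Matrix (Fin n) (Fin n) ℝ} (hM : MemQ M) (hN : MemQ N) :
    MemQ (M + N) := by
  obtain ⟨hne, hsymm, hpos, hker, hdec⟩ := hM
  obtain ⟨-, hsymm', hpos', hker', hdec'⟩ := hN
  refine ⟨fun h => hne ?_, hsymm.add hsymm', hpos.add hpos', ?_, fun A hA x => ?_⟩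
  · have htrace : M.trace + N.trace = 0 := by rw [← Matrix.trace_add, h, Matrix.trace_zero]
    exact hpos.trace_eq_zero_iff.mp (by linarith [hpos.trace_nonneg, hpos'.trace_nonneg])
  · rw [Matrix.add_mulVec, hker, hker', add_zero]
  · simp only [Matrix.add_mulVec, dotProduct_add]
    exact add_le_add (hdec A hA x) (hdec' A hA x)


/-- If `M ∈ 𝒬` then `Z = ∑_{P ∈ 𝒫} Pᵀ M P`, the sum over all permutation matrices `P`,
also belongs to `𝒬`. -/
theorem memQ_sum_perm (n : ℕ) (M : Matrix (Fin n) (Fin n) ℝ) (hM : MemQ M) :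
    MemQ (∑ σ : Equiv.Perm (Fin n), (permMatrix σ)ᵀ * M * permMatrix σ) := by
  refine Finset.sum_induction_nonempty _ MemQ (fun _ _ => MemQ.add) Finset.univ_nonempty
    fun σ _ => ?_
  rw [permMatrix_conj_eq_submatrix]
  exact hM.submatrix σ.symm
end

section
/- Let n ≥ 2, let e ∈ ℝⁿ be the all-ones vector, and let Z ∈ ℝ^{n×n} be a nonzero symmetric positive semidefinite matrix satisfying Ze = 0 and RᵀZR = Z for every n×n permutation matrix R. Then there exists α > 0 such that xᵀZx = α·V(x) for all x ∈ ℝⁿ, where V(x) = Σ_{i=1}^n (x_i − x̄)² and x̄ = (1/n) Σ_{i=1}^n x_i. -/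
open Matrix

theorem permMatrix_mulVec_apply {n : ℕ} (σ : Equiv.Perm (Fin n)) (x : Fin n → ℝ) (i : Fin n) :
    (permMatrix σ *ᵥ x) i = x (σ i) := by
  simp [permMatrix, Matrix.mulVec, dotProduct]

theorem isPermMatrix_permMatrix {n : ℕ} (σ : Equiv.Perm (Fin n)) : IsPermMatrix (permMatrix σ) :=
  ⟨σ, permMatrix_mulVec_apply σ⟩

theorem permMatrix_transpose_mul_mul_apply {n : ℕ} (σ : Equiv.Perm (Fin n))
    (Z : Matrix (Fin n) (Fin n) ℝ) (i j : Fin n) :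
    ((permMatrix σ)ᵀ * Z * permMatrix σ) (σ i) (σ j) = Z i j := by
  simp [permMatrix, Matrix.mul_apply]

theorem exists_perm_apply_eq_apply_eq {ι : Type*} [DecidableEq ι] {p q i j : ι}
    (hpq : p ≠ q) (hij : i ≠ j) : ∃ σ : Equiv.Perm ι, σ p = i ∧ σ q = j := by
  refine ⟨Equiv.swap (Equiv.swap p i q) j * Equiv.swap p i, ?_, by simp⟩
  rw [Equiv.Perm.mul_apply, Equiv.swap_apply_left]
  refine Equiv.swap_apply_of_ne_of_ne (fun h => hpq ?_) hij
  apply (Equiv.swap p i).injective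
  rw [Equiv.swap_apply_left, ← h]

theorem sampleVar_eq {n : ℕ} (hn : n ≠ 0) (x : Fin n → ℝ) :
    sampleVar x = ∑ i, x i ^ 2 - (∑ i, x i) ^ 2 / n := by
  have hn' : (n : ℝ) ≠ 0 := Nat.cast_ne_zero.mpr hn
  simp only [sampleVar, sub_sq, Finset.sum_add_distrib, Finset.sum_sub_distrib,
    ← Finset.sum_mul, ← Finset.mul_sum, Finset.sum_const, Finset.card_univ, Fintype.card_fin,
    nsmul_eq_mul]
  field_simp
  ring

/-- If `n ≥ 2` and `Z` is a nonzero symmetric positive semidefinite matrix with `Ze = 0`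
and `Rᵀ Z R = Z` for every permutation matrix `R`, then `xᵀ Z x = α V(x)` for some
`α > 0`, where `V` is the sample variance. -/
theorem perm_invariant_is_variance (n : ℕ) (hn : 2 ≤ n) (Z : Matrix (Fin n) (Fin n) ℝ)
    (hne : Z ≠ 0) (hsymm : Z.IsSymm) (hpsd : Z.PosSemidef)
    (he : Z *ᵥ (fun _ => (1 : ℝ)) = 0)
    (hZ : ∀ R : Matrix (Fin n) (Fin n) ℝ, IsPermMatrix R → Rᵀ * Z * R = Z) :
    ∃ α : ℝ, 0 < α ∧ ∀ x : Fin n → ℝ, x ⬝ᵥ (Z *ᵥ x) = α * sampleVar x := by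
  let p : Fin n := ⟨0, by omega⟩
  let q : Fin n := ⟨1, by omega⟩
  have hpq : p ≠ q := by simp [p, q]
  have hn0 : n ≠ 0 := by omega
  have hn2 : (2 : ℝ) ≤ n := by exact_mod_cast hn
  have hinv (σ : Equiv.Perm (Fin n)) (i j : Fin n) : Z (σ i) (σ j) = Z i j := by
    rw [← permMatrix_transpose_mul_mul_apply σ Z i j, hZ _ (isPermMatrix_permMatrix σ)]
  have hdiag (i : Fin n) : Z i i = Z p p := by
    simpa using hinv (Equiv.swap p i) p p
  have hoff (i j : Fin n) (hij : i ≠ j) : Z i j = Z p q := by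
    obtain ⟨σ, rfl, rfl⟩ := exists_perm_apply_eq_apply_eq hpq hij
    exact hinv σ p q
  have hentry (i j : Fin n) : Z i j = (if i = j then Z p p - Z p q else 0) + Z p q := by
    split_ifs with h
    · rw [← h, hdiag]; ring
    · rw [hoff i j h]; ring
  have hmulVec (x : Fin n → ℝ) (i : Fin n) :
      (Z *ᵥ x) i = (Z p p - Z p q) * x i + Z p q * ∑ j, x j := by
    simp only [Matrix.mulVec, dotProduct]
    simp_rw [hentry i]
    simp [add_mul, Finset.sum_add_distrib, Finset.mul_sum]
  have hsum : Z p p - Z p q = -(n * Z p q) := by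
    have h := congrFun he p
    rw [hmulVec] at h
    simp at h
    linarith
  have hnonneg : 0 ≤ Z p p := hpsd.diag_nonneg
  have hoff_neg : Z p q < 0 := by
    by_contra! h
    have hb : Z p q = 0 := by nlinarith [mul_le_mul_of_nonneg_right hn2 h]
    have ha : Z p p = 0 := by rw [hb] at hsum; linarith
    exact hne (Matrix.ext fun i j => by simp [hentry i j, ha, hb])
  refine ⟨Z p p - Z p q, by nlinarith, fun x => ?_⟩
  rw [sampleVar_eq hn0]
  have hquad : x ⬝ᵥ (Z *ᵥ x) = (Z p p - Z p q) * ∑ i, x i ^ 2 + Z p q * (∑ i, x i) ^ 2 := by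
    simp only [dotProduct, hmulVec, mul_add, Finset.sum_add_distrib, sq, ← Finset.sum_mul]
    congr 1
    · rw [Finset.mul_sum]
      exact Finset.sum_congr rfl fun i _ => by ring
    · ring
  rw [hquad, hsum]
  field_simp
  ring
end

section
/- Let M ∈ ℝ^{n×n} be a matrix in the class 𝒬 with n ≥ 2, let 𝒫 be the set of all n×n permutation matrices, and define Z = Σ_{P ∈ 𝒫} PᵀMP. Then there exists α > 0 such that xᵀZx = α·V(x) for all x ∈ ℝⁿ, where V(x) = Σ_{i=1}^n (x_i − x̄)² and x̄ = (1/n) Σ_{i=1}^n x_i. -/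
open Matrix

theorem Equiv.Perm.exists_map_pair {ι : Type*} [DecidableEq ι] {i j k l : ι} (hij : i ≠ j)
    (hkl : k ≠ l) : ∃ τ : Equiv.Perm ι, τ i = k ∧ τ j = l := by
  refine ⟨Equiv.swap (Equiv.swap i k j) l * Equiv.swap i k, ?_, ?_⟩
  · have hk : k ≠ Equiv.swap i k j := fun h =>
      hij ((Equiv.swap i k).injective ((Equiv.swap_apply_left i k).trans h))
    simp [Equiv.swap_apply_of_ne_of_ne hk hkl]
  · simp

/-- A matrix invariant under simultaneous permutations of rows and columns has constant diagonal
and constant off-diagonal entries. -/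
theorem Matrix.exists_eq_ite_of_perm_invariant {ι R : Type*} [DecidableEq ι] [Nontrivial ι]
    {Z : Matrix ι ι R} (hZ : ∀ (τ : Equiv.Perm ι) i j, Z (τ i) (τ j) = Z i j) :
    ∃ d b : R, ∀ i j, Z i j = if i = j then d else b := by
  obtain ⟨k, l, hkl⟩ := exists_pair_ne ι
  refine ⟨Z k k, Z k l, fun i j => ?_⟩
  split_ifs with h
  · subst h
    simpa using (hZ (Equiv.swap i k) i i).symm
  · obtain ⟨τ, rfl, rfl⟩ := Equiv.Perm.exists_map_pair h hkl
    exact (hZ τ i j).symm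

theorem permMatrix_conj_apply {n : ℕ} (σ : Equiv.Perm (Fin n)) (M : Matrix (Fin n) (Fin n) ℝ)
    (i j : Fin n) : ((permMatrix σ)ᵀ * M * permMatrix σ) i j = M (σ.symm i) (σ.symm j) := by
  simp [Matrix.mul_apply, permMatrix, ← Equiv.symm_apply_eq]

theorem sum_permMatrix_conj_apply {n : ℕ} (M : Matrix (Fin n) (Fin n) ℝ) (i j : Fin n) :
    (∑ σ : Equiv.Perm (Fin n), (permMatrix σ)ᵀ * M * permMatrix σ) i j =
      ∑ σ : Equiv.Perm (Fin n), M (σ i) (σ j) := by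
  simp only [Matrix.sum_apply, permMatrix_conj_apply]
  exact Equiv.sum_comp (Equiv.inv (Equiv.Perm (Fin n))) fun σ : Equiv.Perm (Fin n) => M (σ i) (σ j)

/-- **Lemma 2.** If `M ∈ 𝒬` and `Z = ∑_{P ∈ 𝒫} Pᵀ M P` (sum over all permutation
matrices), then there is `α > 0` with `xᵀ Z x = α V(x)` for all `x`, where `V` is the
sample variance. -/
theorem sum_perm_is_variance (n : ℕ) (hn : 2 ≤ n) (M : Matrix (Fin n) (Fin n) ℝ)
    (hM : MemQ M) :
    ∃ α : ℝ, 0 < α ∧ ∀ x : Fin n → ℝ,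
      x ⬝ᵥ ((∑ σ : Equiv.Perm (Fin n), (permMatrix σ)ᵀ * M * permMatrix σ) *ᵥ x) =
        α * sampleVar x := by
  obtain ⟨hM0, -, hpsd, hMe, -⟩ := hM
  have : Nontrivial (Fin n) := Fin.nontrivial_iff_two_le.mpr hn
  have hn' : (2 : ℝ) ≤ n := by exact_mod_cast hn
  have hrow : ∀ i, ∑ j, M i j = 0 := fun i => by
    simpa [Matrix.mulVec, dotProduct] using congrFun hMe i
  have htr : 0 < M.trace :=
    hpsd.trace_nonneg.lt_of_ne fun h => hM0 (hpsd.trace_eq_zero_iff.mp h.symm)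
  set Z := ∑ σ : Equiv.Perm (Fin n), (permMatrix σ)ᵀ * M * permMatrix σ
  have hZapp : ∀ i j, Z i j = ∑ σ : Equiv.Perm (Fin n), M (σ i) (σ j) :=
    sum_permMatrix_conj_apply M
  have hZinv : ∀ (τ : Equiv.Perm (Fin n)) i j, Z (τ i) (τ j) = Z i j := fun τ i j => by
    rw [hZapp, hZapp]
    exact Equiv.sum_comp (Equiv.mulRight τ) fun σ : Equiv.Perm (Fin n) => M (σ i) (σ j)
  obtain ⟨d, b, hdb⟩ := Matrix.exists_eq_ite_of_perm_invariant hZinv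
  have hZrow : ∀ i, ∑ j, Z i j = 0 := fun i => by
    simp_rw [hZapp]
    rw [Finset.sum_comm]
    exact Finset.sum_eq_zero fun σ _ => (Equiv.sum_comp σ fun j => M (σ i) j).trans (hrow _)
  have hZtr : 0 < ∑ i, Z i i := by
    simp_rw [hZapp]
    rw [Finset.sum_comm]
    exact Finset.sum_pos (fun σ _ => htr.trans_eq (Equiv.sum_comp σ fun i => M i i).symm)
      Finset.univ_nonempty
  have hentry : ∀ i j, Z i j = (if i = j then d - b else 0) + b := fun i j => by
    rw [hdb]; split_ifs <;> ring
  have hsum : d - b + n * b = 0 := by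
    simpa [hentry, Finset.sum_add_distrib] using hZrow ⟨0, by omega⟩
  have hd : 0 < d := by
    have h : 0 < (n : ℝ) * d := by simpa [hdb] using hZtr
    exact pos_of_mul_pos_right h (by linarith)
  refine ⟨d - b, by nlinarith, fun x => ?_⟩
  have hquad : x ⬝ᵥ (Z *ᵥ x) = (d - b) * ∑ i, x i ^ 2 + b * (∑ i, x i) ^ 2 := by
    simp only [dotProduct, Matrix.mulVec, hentry, add_mul, ite_mul, zero_mul,
      Finset.sum_add_distrib, Finset.sum_ite_eq, Finset.mem_univ, if_true, mul_add,
      ← Finset.mul_sum, ← Finset.sum_mul]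
    have h : ∑ i, x i * ((d - b) * x i) = (d - b) * ∑ i, x i ^ 2 := by
      rw [Finset.mul_sum]
      exact Finset.sum_congr rfl fun i _ => by ring
    rw [h]
    ring
  rw [hquad, sampleVar_eq (by omega)]
  have hdb' : d - b = -(n * b) := by linarith
  rw [hdb']
  field_simp
  ring
end

section
/- Let n ≥ 8. Then there exist a matrix A ∈ 𝒜 and a vector x ∈ ℝⁿ such that V(Ax) > V(x), where V(x) = Σ_{i=1}^n (x_i − x̄)² and x̄ = (1/n) Σ_{i=1}^n x_i. Consequently, the sample variance V is not a Lyapunov function for the symmetric, equal-neighbor model. -/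
open Matrix

/-- The closed adjacency relation of the double star with hubs `0`, `1`, leaves `2, 3, 4` at `0`
and `5, 6, 7` at `1`, in which every further node is joined to both hubs. -/
def doubleStarAdj (a b : ℕ) : Prop :=
  a = b ∨ (a ≤ 1 ∧ b ≤ 1) ∨ (a ≤ 1 ∧ 8 ≤ b) ∨ (8 ≤ a ∧ b ≤ 1) ∨
    (a = 0 ∧ 2 ≤ b ∧ b ≤ 4) ∨ (2 ≤ a ∧ a ≤ 4 ∧ b = 0) ∨
    (a = 1 ∧ 5 ≤ b ∧ b ≤ 7) ∨ (5 ≤ a ∧ a ≤ 7 ∧ b = 1)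

instance (a b : ℕ) : Decidable (doubleStarAdj a b) := by
  unfold doubleStarAdj; infer_instance

lemma doubleStarAdj_self (a : ℕ) : doubleStarAdj a a := Or.inl rfl

lemma doubleStarAdj_comm (a b : ℕ) : doubleStarAdj a b ↔ doubleStarAdj b a := by
  unfold doubleStarAdj; omega

/-- The reciprocal of the closed degree of `a` in the double star on `8 + k` nodes. -/
noncomputable def doubleStarWeight (k a : ℕ) : ℝ :=
  if a ≤ 1 then 1 / (k + 5) else if a ≤ 7 then 1 / 2 else 1 / 3

lemma doubleStarWeight_pos (k a : ℕ) : 0 < doubleStarWeight k a := by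
  unfold doubleStarWeight; split_ifs <;> positivity

/-- The equal-neighbor averaging matrix of the double star on `8 + k` nodes. -/
noncomputable def doubleStarMatrix (k : ℕ) : Matrix (Fin (8 + k)) (Fin (8 + k)) ℝ :=
  fun i j => if doubleStarAdj i j then doubleStarWeight k i else 0

lemma doubleStarMatrix_pos_iff {k : ℕ} (i j : Fin (8 + k)) :
    0 < doubleStarMatrix k i j ↔ doubleStarAdj i j := by
  unfold doubleStarMatrix
  split_ifs with h <;> simp [h, doubleStarWeight_pos]

lemma sum_fin_eight_add (k : ℕ) (f : ℕ → ℝ) :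
    ∑ i : Fin (8 + k), f i =
      f 0 + f 1 + f 2 + f 3 + f 4 + f 5 + f 6 + f 7 + ∑ y ∈ Finset.range k, f (8 + y) := by
  rw [Fin.sum_univ_eq_sum_range f, Finset.sum_range_add]
  simp only [Finset.sum_range_succ, Finset.sum_range_zero, zero_add]

/-- The sum of `f` over the closed neighborhood of `a` in the double star. -/
noncomputable def doubleStarNeighborSum (k : ℕ) (f : ℕ → ℝ) (a : ℕ) : ℝ :=
  if a = 0 then f 0 + f 1 + f 2 + f 3 + f 4 + ∑ y ∈ Finset.range k, f (8 + y)
  else if a = 1 then f 0 + f 1 + f 5 + f 6 + f 7 + ∑ y ∈ Finset.range k, f (8 + y)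
  else if a ≤ 4 then f 0 + f a
  else if a ≤ 7 then f 1 + f a
  else f 0 + f 1 + f a

lemma sum_doubleStarMatrix_mul {k : ℕ} (f : ℕ → ℝ) (i : Fin (8 + k)) :
    ∑ j, doubleStarMatrix k i j * f j =
      doubleStarWeight k i * doubleStarNeighborSum k f i := by
  obtain ⟨a, ha⟩ := i
  have hsum : ∑ j, doubleStarMatrix k ⟨a, ha⟩ j * f j =
      doubleStarWeight k a * ∑ j : Fin (8 + k), if doubleStarAdj a j then f j else 0 := by
    rw [Finset.mul_sum]
    refine Finset.sum_congr rfl fun j _ => ?_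
    simp only [doubleStarMatrix]
    split_ifs <;> simp
  rw [hsum, sum_fin_eight_add k fun b => if doubleStarAdj a b then f b else 0]
  congr 1
  by_cases h : a < 8
  · interval_cases a <;>
      simp [doubleStarAdj, doubleStarNeighborSum] <;>
      exact Finset.sum_eq_zero fun y _ => if_neg (by omega)
  · obtain ⟨m, rfl⟩ := Nat.exists_eq_add_of_le (not_lt.mp h)
    have hm : m < k := by omega
    have hadj (b : ℕ) : doubleStarAdj (8 + m) b ↔ b ≤ 1 ∨ 8 + m = b := by
      unfold doubleStarAdj; omega
    have hne (c : ℕ) (hc : c < 8) : 8 + m ≠ c := by omega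
    have htail (y : ℕ) : ¬ 8 + y ≤ 1 := by omega
    simp [hadj, hne, htail, hm, doubleStarNeighborSum, show ¬ 8 + m ≤ 4 by omega,
      show ¬ 8 + m ≤ 7 by omega]

lemma doubleStarMatrix_memA (k : ℕ) : MemA (doubleStarMatrix k) := by
  refine ⟨⟨fun i j => ?_, fun i => ?_⟩, fun i => ?_, fun i j l hj hl => ?_, fun i j => ?_,
    fun i j => ?_⟩
  · unfold doubleStarMatrix
    split_ifs
    exacts [(doubleStarWeight_pos _ _).le, le_rfl]
  · have h := sum_doubleStarMatrix_mul (fun _ => 1) i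
    simp only [mul_one] at h
    rw [h]
    unfold doubleStarWeight doubleStarNeighborSum
    have hk : (k : ℝ) + 5 ≠ 0 := by positivity
    split_ifs <;> first | omega | (simp; try field_simp; try ring)
  · exact (doubleStarMatrix_pos_iff i i).2 (doubleStarAdj_self _)
  · rw [doubleStarMatrix_pos_iff] at hj hl
    simp [doubleStarMatrix, hj, hl]
  · rw [doubleStarMatrix_pos_iff, doubleStarMatrix_pos_iff, doubleStarAdj_comm]
  · simp only [doubleStarMatrix_pos_iff]
    have hub (i : Fin (8 + k)) : Relation.ReflTransGen
        (fun a b : Fin (8 + k) => doubleStarAdj a b) i ⟨0, by omega⟩ := by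
      by_cases h : doubleStarAdj i 0
      · exact .single h
      · have h₁ : doubleStarAdj i 1 := by unfold doubleStarAdj at h ⊢; omega
        exact .trans (b := ⟨1, by omega⟩) (.single h₁) (.single (by simp [doubleStarAdj]))
    have : Std.Symm fun a b : Fin (8 + k) => doubleStarAdj a b :=
      ⟨fun a b => (doubleStarAdj_comm a b).1⟩
    exact (hub i).trans (Relation.ReflTransGen.stdSymm.symm _ _ (hub j))

/-- The values `3, -3` at the hubs, `1, -1` at their leaves and `0` elsewhere. -/
noncomputable def doubleStarValue (a : ℕ) : ℝ :=
  if a = 0 then 3 else if a = 1 then -3 else if a ≤ 4 then 1 else if a ≤ 7 then -1 else 0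

lemma doubleStarValue_eight_add (y : ℕ) : doubleStarValue (8 + y) = 0 := by
  unfold doubleStarValue
  split_ifs <;> first | omega | rfl

/-- The values obtained from `doubleStarValue` after one averaging step. -/
noncomputable def doubleStarAveraged (k a : ℕ) : ℝ :=
  if a = 0 then 3 / (k + 5) else if a = 1 then -(3 / (k + 5)) else
    if a ≤ 4 then 2 else if a ≤ 7 then -2 else 0

lemma doubleStarAveraged_eight_add (k y : ℕ) : doubleStarAveraged k (8 + y) = 0 := by
  unfold doubleStarAveraged
  split_ifs <;> first | omega | rfl

lemma doubleStarMatrix_mulVec_value (k : ℕ) :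
    doubleStarMatrix k *ᵥ (fun i => doubleStarValue i) =
      fun i : Fin (8 + k) => doubleStarAveraged k i := by
  ext i
  rw [mulVec, dotProduct, sum_doubleStarMatrix_mul]
  unfold doubleStarWeight doubleStarNeighborSum doubleStarAveraged
  simp only [doubleStarValue_eight_add, Finset.sum_const_zero, add_zero]
  split_ifs <;> first | omega | (simp [doubleStarValue, *]; try norm_num; try ring)

lemma sampleVar_eq_sum_sq {n : ℕ} {x : Fin n → ℝ} (hx : ∑ i, x i = 0) :
    sampleVar x = ∑ i, x i ^ 2 := by
  simp [sampleVar, hx]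

lemma sampleVar_doubleStarValue (k : ℕ) :
    sampleVar (fun i : Fin (8 + k) => doubleStarValue i) = 24 := by
  rw [sampleVar_eq_sum_sq, sum_fin_eight_add k fun a => doubleStarValue a ^ 2]
  · simp only [doubleStarValue_eight_add]
    norm_num [doubleStarValue]
  · rw [sum_fin_eight_add]
    simp only [doubleStarValue_eight_add]
    norm_num [doubleStarValue]

lemma sampleVar_doubleStarAveraged (k : ℕ) :
    sampleVar (fun i : Fin (8 + k) => doubleStarAveraged k i) = 24 + 2 * (3 / (k + 5)) ^ 2 := by
  rw [sampleVar_eq_sum_sq, sum_fin_eight_add k fun a => doubleStarAveraged k a ^ 2]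
  · simp only [doubleStarAveraged_eight_add]
    simp [doubleStarAveraged]
    ring
  · rw [sum_fin_eight_add]
    simp only [doubleStarAveraged_eight_add]
    simp [doubleStarAveraged]

/-- For `n ≥ 8` the sample variance `V` is not a Lyapunov function for the symmetric,
equal-neighbor model: there exist `A ∈ 𝒜` and `x ∈ ℝⁿ` with `V(Ax) > V(x)`. -/
theorem variance_not_lyapunov (n : ℕ) (hn : 8 ≤ n) :
    ∃ (A : Matrix (Fin n) (Fin n) ℝ) (x : Fin n → ℝ),
      MemA A ∧ sampleVar (A *ᵥ x) > sampleVar x := by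
  obtain ⟨k, rfl⟩ := Nat.exists_eq_add_of_le hn
  refine ⟨doubleStarMatrix k, fun i => doubleStarValue i, doubleStarMatrix_memA k, ?_⟩
  rw [doubleStarMatrix_mulVec_value, sampleVar_doubleStarValue, sampleVar_doubleStarAveraged]
  have : (0 : ℝ) < (3 / (k + 5)) ^ 2 := by positivity
  linarith
end
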